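/- arXiv:2504.09146 — 8 statements merged into one kernel-verified Lean document; each statement's English description precedes it below -/
import Mathlib

section
/- Let a, μ, γ, p, h, τ be positive real constants and let c > 0 satisfy c ≤ h·(e^{γτ} − 1)/(γ + p·(e^{γτ} − 1)). Then e^{-γτ}·( c + (1/γ)·( p·e^{-μτ}·c·e^{-a c} − h )·( e^{γτ} − 1 ) ) < 0. -/
open Real

theorem M_tau_negative
    (a μ γ p h τ c : ℝ)
    (ha : 0 < a) (hμ : 0 < μ) (hγ : 0 < γ) (hp : 0 < p) (hh : 0 < h)
    (hτ : 0 < τ) (hc : 0 < c)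
    (hcle : c ≤ h * (Real.exp (γ * τ) - 1) / (γ + p * (Real.exp (γ * τ) - 1))) :
    Real.exp (-γ * τ) *
      (c + (1 / γ) * (p * Real.exp (-μ * τ) * c * Real.exp (-a * c) - h) *
        (Real.exp (γ * τ) - 1)) < 0 := by
  have hE : 0 < Real.exp (γ * τ) - 1 := by
    have := Real.one_lt_exp_iff.mpr (mul_pos hγ hτ)
    linarith
  have hx : Real.exp (-μ * τ) < 1 := Real.exp_lt_one_iff.mpr (by nlinarith [mul_pos hμ hτ])
  have hy : Real.exp (-a * c) < 1 := Real.exp_lt_one_iff.mpr (by nlinarith [mul_pos ha hc])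
  have hx0 := Real.exp_pos (-μ * τ)
  have hy0 := Real.exp_pos (-a * c)
  apply mul_neg_of_pos_of_neg (Real.exp_pos _)
  generalize Real.exp (γ * τ) - 1 = E at *
  generalize Real.exp (-μ * τ) = x at *
  generalize Real.exp (-a * c) = y at *
  have hD : 0 < γ + p * E := by positivity
  rw [le_div_iff₀ hD] at hcle
  have hxy : x * y < 1 := by nlinarith
  have hpos : 0 < p * c * E := by positivity
  have key : γ * c + (p * x * c * y - h) * E < 0 := by
    have := mul_lt_mul_of_pos_left hxy hpos
    linarith
  have heq : c + 1 / γ * (p * x * c * y - h) * E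
      = (γ * c + (p * x * c * y - h) * E) / γ := by
    field_simp
  rw [heq]
  exact div_neg_of_neg_of_pos key hγ
end

section
/- Let a, μ, γ, p > 0, τ ≥ 0 and assume p·e^{-μτ} > γ. Then there exists a unique M̄ ∈ (0, 1/a) such that p·e^{-μτ}·e^{-a M̄}·(1 − a·M̄) = γ; moreover M̄ is the unique positive real number satisfying this equation. -/
open Real

theorem unique_critical_point
    (a μ γ p τ : ℝ)
    (ha : 0 < a) (hμ : 0 < μ) (hγ : 0 < γ) (hp : 0 < p) (hτ : 0 ≤ τ)
    (hpe : p * Real.exp (-μ * τ) > γ) :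
    ∃ Mb : ℝ, (Mb ∈ Set.Ioo 0 (1 / a) ∧
        p * Real.exp (-μ * τ) * Real.exp (-a * Mb) * (1 - a * Mb) = γ) ∧
      ∀ M : ℝ, 0 < M →
        p * Real.exp (-μ * τ) * Real.exp (-a * M) * (1 - a * M) = γ → M = Mb := by
  set c := p * Real.exp (-μ * τ) with hc
  have hc0 : 0 < c := lt_trans hγ hpe
  have anti : ∀ x y : ℝ, x < y → 0 < 1 - a * y →
      c * Real.exp (-a * y) * (1 - a * y) < c * Real.exp (-a * x) * (1 - a * x) := by
    intro x y hxy hy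
    have h0 : a * x < a * y := mul_lt_mul_of_pos_left hxy ha
    have h1 : Real.exp (-a * y) < Real.exp (-a * x) := Real.exp_lt_exp.mpr (by linarith)
    have h2 : c * Real.exp (-a * y) < c * Real.exp (-a * x) := mul_lt_mul_of_pos_left h1 hc0
    have h3 : 0 < c * Real.exp (-a * x) := by positivity
    calc c * Real.exp (-a * y) * (1 - a * y) < c * Real.exp (-a * x) * (1 - a * y) :=
          mul_lt_mul_of_pos_right h2 hy
      _ < c * Real.exp (-a * x) * (1 - a * x) := mul_lt_mul_of_pos_left (by linarith) h3
  have pos : ∀ x : ℝ, c * Real.exp (-a * x) * (1 - a * x) = γ → 0 < 1 - a * x := by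
    intro x hx
    have h3 : 0 < c * Real.exp (-a * x) := by positivity
    exact pos_of_mul_pos_right (hx ▸ hγ) h3.le
  have hcont : ContinuousOn (fun x : ℝ => c * Real.exp (-a * x) * (1 - a * x))
      (Set.Icc 0 (1 / a)) := by fun_prop
  have hab : (0 : ℝ) ≤ 1 / a := by positivity
  have hmem : γ ∈ Set.Ioo (c * Real.exp (-a * (1 / a)) * (1 - a * (1 / a)))
      (c * Real.exp (-a * 0) * (1 - a * 0)) := by
    constructor
    · rw [mul_one_div_cancel ha.ne']
      simpa using hγ
    · simpa using hpe
  obtain ⟨Mb, hMb, hE⟩ := intermediate_value_Ioo' hab hcont hmem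
  have hE' : c * Real.exp (-a * Mb) * (1 - a * Mb) = γ := hE
  refine ⟨Mb, ⟨hMb, hE'⟩, fun M _ hM => ?_⟩
  rcases lt_trichotomy M Mb with h | h | h
  · have := anti M Mb h (pos Mb hE')
    linarith
  · exact h
  · have := anti Mb M h (pos M hM)
    linarith
end

section
/- Let a, μ, γ, p > 0, τ ≥ 0 with p·e^{-μτ} > γ, let M̄ ∈ (0, 1/a) be the unique positive solution of p·e^{-μτ}·e^{-aM̄}·(1 − aM̄) = γ, and set h* = p·e^{-μτ}·M̄·e^{-aM̄} − γ·M̄. Then h* > 0, and for g_h(M) = p·e^{-μτ}·M·e^{-aM} − γ·M − h: (i) if 0 < h < h* then g_h has exactly two zeros in (0, ∞), one in (0, M̄) and one in (M̄, ∞); (ii) if h = h* then M̄ is the unique zero of g_h in (0, ∞); (iii) if h > h* then g_h has no zero in (0, ∞). -/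
open Real

lemma aux_deriv (P a γ x : ℝ) :
    HasDerivAt (fun M : ℝ => P * M * Real.exp (-a * M) - γ * M)
      (P * Real.exp (-a * x) * (1 - a * x) - γ) x := by
  have h1 : HasDerivAt (fun M : ℝ => -a * M) (-a) x := by
    simpa using (hasDerivAt_id x).const_mul (-a)
  have h2 : HasDerivAt (fun M : ℝ => P * M) P x := by
    simpa using (hasDerivAt_id x).const_mul P
  have h3 : HasDerivAt (fun M : ℝ => γ * M) γ x := by
    simpa using (hasDerivAt_id x).const_mul γ
  refine ((h2.mul h1.exp).sub h3).congr_deriv ?_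
  ring

lemma aux_core (P a γ b : ℝ) (ha : 0 < a) (hγ : 0 < γ) (hP : γ < P) (hb : 0 < b)
    (hab : a * b < 1) (heq : P * Real.exp (-a * b) * (1 - a * b) = γ)
    (f : ℝ → ℝ) (hf : f = fun M : ℝ => P * M * Real.exp (-a * M) - γ * M) :
    Continuous f ∧ StrictMonoOn f (Set.Icc 0 b) ∧ StrictAntiOn f (Set.Ici b) ∧
      f 0 = 0 ∧ ∃ c, b < c ∧ f c ≤ 0 := by
  have hP0 : 0 < P := hγ.trans hP
  have hd : ∀ x, HasDerivAt f (P * Real.exp (-a * x) * (1 - a * x) - γ) x := by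
    intro x
    rw [hf]
    exact aux_deriv P a γ x
  have hc : Continuous f := by
    rw [hf]
    fun_prop
  refine ⟨hc, ?_, ?_, by simp [hf], P / (γ * a), ?_, ?_⟩
  · refine strictMonoOn_of_deriv_pos (convex_Icc 0 b) hc.continuousOn ?_
    intro x hx
    rw [interior_Icc] at hx
    rw [(hd x).deriv]
    have hlt : a * x < a * b := mul_lt_mul_of_pos_left hx.2 ha
    have he : Real.exp (-a * b) < Real.exp (-a * x) := Real.exp_lt_exp.2 (by linarith)
    have h1 : P * Real.exp (-a * b) < P * Real.exp (-a * x) :=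
      mul_lt_mul_of_pos_left he hP0
    have h2 : P * Real.exp (-a * b) * (1 - a * b) < P * Real.exp (-a * x) * (1 - a * x) :=
      mul_lt_mul'' h1 (by linarith) (by positivity) (by linarith)
    linarith
  · refine strictAntiOn_of_deriv_neg (convex_Ici b) hc.continuousOn ?_
    intro x hx
    rw [interior_Ici] at hx
    rw [(hd x).deriv]
    have hlt : a * b < a * x := mul_lt_mul_of_pos_left hx ha
    have he : Real.exp (-a * x) < Real.exp (-a * b) := Real.exp_lt_exp.2 (by linarith)
    have h1 : P * Real.exp (-a * x) < P * Real.exp (-a * b) :=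
      mul_lt_mul_of_pos_left he hP0
    rcases le_or_gt (1 - a * x) 0 with h0 | h0
    · have : P * Real.exp (-a * x) * (1 - a * x) ≤ 0 :=
        mul_nonpos_of_nonneg_of_nonpos (by positivity) h0
      linarith
    · have h2 : P * Real.exp (-a * x) * (1 - a * x) < P * Real.exp (-a * b) * (1 - a * b) :=
        mul_lt_mul'' h1 (by linarith) (by positivity) h0.le
      linarith
  · rw [lt_div_iff₀ (by positivity)]
    nlinarith
  · have hM : 0 < P / (γ * a) := by positivity
    have hE : P ≤ γ * Real.exp (a * (P / (γ * a))) := by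
      have h1 := Real.add_one_le_exp (a * (P / (γ * a)))
      have h2 : γ * (a * (P / (γ * a))) = P := by field_simp
      nlinarith
    have h3 : P * Real.exp (-a * (P / (γ * a))) ≤ γ := by
      rw [neg_mul, Real.exp_neg, ← div_eq_mul_inv, div_le_iff₀ (Real.exp_pos _)]
      exact hE
    have h4 := mul_le_mul_of_nonneg_right h3 hM.le
    rw [hf]
    simp only
    linarith

theorem equilibria_count_by_harvest
    (a μ γ p τ Mb : ℝ)
    (ha : 0 < a) (hμ : 0 < μ) (hγ : 0 < γ) (hp : 0 < p) (hτ : 0 ≤ τ)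
    (hpe : p * Real.exp (-μ * τ) > γ)
    (hMb : Mb ∈ Set.Ioo 0 (1 / a))
    (hMbeq : p * Real.exp (-μ * τ) * Real.exp (-a * Mb) * (1 - a * Mb) = γ) :
    0 < p * Real.exp (-μ * τ) * Mb * Real.exp (-a * Mb) - γ * Mb ∧
    ∀ h : ℝ,
      ((0 < h ∧ h < p * Real.exp (-μ * τ) * Mb * Real.exp (-a * Mb) - γ * Mb) →
        ((∃! M : ℝ, M ∈ Set.Ioo 0 Mb ∧
            p * Real.exp (-μ * τ) * M * Real.exp (-a * M) - γ * M - h = 0) ∧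
         (∃! M : ℝ, M ∈ Set.Ioi Mb ∧
            p * Real.exp (-μ * τ) * M * Real.exp (-a * M) - γ * M - h = 0) ∧
         (∀ M : ℝ, 0 < M →
            p * Real.exp (-μ * τ) * M * Real.exp (-a * M) - γ * M - h = 0 →
            M ∈ Set.Ioo 0 Mb ∨ M ∈ Set.Ioi Mb))) ∧
      (h = p * Real.exp (-μ * τ) * Mb * Real.exp (-a * Mb) - γ * Mb →
        (∀ M : ℝ, 0 < M →
          (p * Real.exp (-μ * τ) * M * Real.exp (-a * M) - γ * M - h = 0 ↔ M = Mb))) ∧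
      (h > p * Real.exp (-μ * τ) * Mb * Real.exp (-a * Mb) - γ * Mb →
        ∀ M : ℝ, 0 < M →
          p * Real.exp (-μ * τ) * M * Real.exp (-a * M) - γ * M - h ≠ 0) := by
  obtain ⟨hb, hb1⟩ := hMb
  have hab : a * Mb < 1 := by
    rw [lt_div_iff₀ ha] at hb1
    linarith
  generalize p * Real.exp (-μ * τ) = P at *
  obtain ⟨f, hf⟩ : ∃ f : ℝ → ℝ, f = fun M : ℝ => P * M * Real.exp (-a * M) - γ * M := ⟨_, rfl⟩
  obtain ⟨hc, hmono, hanti, hf0, c, hbc, hfc⟩ := aux_core P a γ Mb ha hγ hpe hb hab hMbeq f hf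
  have hfx : ∀ x : ℝ, P * x * Real.exp (-a * x) - γ * x = f x := fun x => by rw [hf]
  simp only [hfx]
  have hmax : ∀ M, 0 < M → M ≠ Mb → f M < f Mb := by
    intro M hM hne
    rcases lt_or_gt_of_ne hne with h | h
    · exact hmono ⟨hM.le, h.le⟩ ⟨hb.le, le_rfl⟩ h
    · exact hanti (Set.mem_Ici.2 le_rfl) (Set.mem_Ici.2 h.le) h
  refine ⟨?_, fun h => ⟨?_, ?_, ?_⟩⟩
  · have := hmono ⟨le_rfl, hb.le⟩ ⟨hb.le, le_rfl⟩ hb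
    linarith
  · rintro ⟨h0, h1⟩
    refine ⟨?_, ?_, ?_⟩
    · obtain ⟨x, hx, hxe⟩ := intermediate_value_Ioo hb.le hc.continuousOn
        (show h ∈ Set.Ioo (f 0) (f Mb) from ⟨by linarith, h1⟩)
      refine ⟨x, ⟨hx, by linarith⟩, ?_⟩
      rintro y ⟨hy, hye⟩
      exact hmono.injOn ⟨hy.1.le, hy.2.le⟩ ⟨hx.1.le, hx.2.le⟩ (by linarith)
    · obtain ⟨x, hx, hxe⟩ := intermediate_value_Ioo' hbc.le hc.continuousOn
        (show h ∈ Set.Ioo (f c) (f Mb) from ⟨by linarith, h1⟩)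
      refine ⟨x, ⟨hx.1, by linarith⟩, ?_⟩
      rintro y ⟨hy, hye⟩
      exact hanti.injOn (Set.mem_Ici.2 (le_of_lt hy)) (Set.mem_Ici.2 hx.1.le) (by linarith)
    · intro M hM hMe
      rcases lt_trichotomy M Mb with hlt | rfl | hgt
      · exact Or.inl ⟨hM, hlt⟩
      · linarith
      · exact Or.inr hgt
  · intro hh M hM
    constructor
    · intro hMe
      by_contra hne
      have := hmax M hM hne
      linarith
    · rintro rfl
      linarith
  · intro hh M hM hMe
    by_cases hne : M = Mb
    · rw [hne] at hMe
      linarith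
    · have := hmax M hM hne
      linarith
end

section
/- Let a, μ, γ, p > 0, τ > 0, let M* > 0, set I = p·e^{-μτ}·(a·M* − 1)·e^{-a·M*} − γ, and suppose I > 0. If ω > 0 and λ = i·ω is a root of λ + γ − p·e^{-μτ}·(1 − a·M*)·e^{-a·M*}·e^{-λτ} = 0, then ω = √(I² + 2·γ·I). -/
open Real Complex

theorem omega_formula_from_I
    (a μ γ p τ Ms Iv ω : ℝ)
    (ha : 0 < a) (hμ : 0 < μ) (hγ : 0 < γ) (hp : 0 < p) (hτ : 0 < τ)
    (hMs : 0 < Ms)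
    (hIv : Iv = p * Real.exp (-μ * τ) * (a * Ms - 1) * Real.exp (-a * Ms) - γ)
    (hIpos : 0 < Iv)
    (hω : 0 < ω)
    (hroot : Complex.I * (ω : ℂ) + (γ : ℂ) -
        ((p * Real.exp (-μ * τ) * (1 - a * Ms) * Real.exp (-a * Ms) : ℝ) : ℂ) *
          Complex.exp (-(Complex.I * (ω : ℂ)) * (τ : ℂ)) = 0) :
    ω = Real.sqrt (Iv ^ 2 + 2 * γ * Iv) := by
  have hK : p * Real.exp (-μ * τ) * (1 - a * Ms) * Real.exp (-a * Ms) = -(Iv + γ) := by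
    rw [hIv]; ring
  rw [hK] at hroot
  have he : Complex.exp (-(Complex.I * (ω : ℂ)) * (τ : ℂ))
      = ((Real.cos (ω * τ) : ℝ) : ℂ) - ((Real.sin (ω * τ) : ℝ) : ℂ) * Complex.I := by
    have h1 : -(Complex.I * (ω : ℂ)) * (τ : ℂ) = (((-(ω * τ)) : ℝ) : ℂ) * Complex.I := by
      push_cast; ring
    rw [h1, Complex.exp_mul_I, ← Complex.ofReal_cos, ← Complex.ofReal_sin, Real.cos_neg,
      Real.sin_neg]
    push_cast; ring
  rw [he] at hroot
  have hcs := Real.sin_sq_add_cos_sq (ω * τ)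
  generalize Real.cos (ω * τ) = c at hroot hcs
  generalize Real.sin (ω * τ) = s at hroot hcs
  have hre := congrArg Complex.re hroot
  have him := congrArg Complex.im hroot
  simp only [Complex.sub_re, Complex.add_re, Complex.mul_re, Complex.sub_im, Complex.add_im,
    Complex.mul_im, Complex.ofReal_re, Complex.ofReal_im, Complex.I_re, Complex.I_im,
    Complex.zero_re, Complex.zero_im] at hre him
  have h1 : γ = -(Iv + γ) * c := by linarith
  have h2 : ω = (Iv + γ) * s := by linarith
  have h3 : Iv ^ 2 + 2 * γ * Iv = ω ^ 2 := by
    have h4 : ω ^ 2 + γ ^ 2 = (Iv + γ) ^ 2 := by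
      calc ω ^ 2 + γ ^ 2 = ((Iv + γ) * s) ^ 2 + (-(Iv + γ) * c) ^ 2 := by rw [← h1, ← h2]
        _ = (Iv + γ) ^ 2 * (s ^ 2 + c ^ 2) := by ring
        _ = (Iv + γ) ^ 2 := by rw [hcs, mul_one]
    linarith
  rw [h3, Real.sqrt_sq hω.le]
end

section
/- Let a, μ, γ, p > 0, h ≥ 0, let T be an open interval of positive reals, and let M : T → ℝ be differentiable with M(τ) > 0, p·M(τ)·e^{-a·M(τ)}·e^{-μτ} = γ·M(τ) + h, and p·e^{-μτ}·e^{-a·M(τ)}·(1 − a·M(τ)) < γ for every τ ∈ T. Then M′(τ) < 0 for every τ ∈ T. -/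
open Real

theorem equilibrium_decreasing_in_tau
    (a μ γ p h t₁ t₂ : ℝ)
    (ha : 0 < a) (hμ : 0 < μ) (hγ : 0 < γ) (hp : 0 < p) (hh : 0 ≤ h)
    (ht₁ : 0 ≤ t₁)
    (M M' : ℝ → ℝ)
    (hderiv : ∀ τ ∈ Set.Ioo t₁ t₂, HasDerivAt M (M' τ) τ)
    (hpos : ∀ τ ∈ Set.Ioo t₁ t₂, 0 < M τ)
    (heq : ∀ τ ∈ Set.Ioo t₁ t₂,
      p * M τ * Real.exp (-a * M τ) * Real.exp (-μ * τ) = γ * M τ + h)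
    (hg' : ∀ τ ∈ Set.Ioo t₁ t₂,
      p * Real.exp (-μ * τ) * Real.exp (-a * M τ) * (1 - a * M τ) < γ) :
    ∀ τ ∈ Set.Ioo t₁ t₂, M' τ < 0 := by
  intro τ hτ
  have hd := hderiv τ hτ
  have hE1 : HasDerivAt (fun x => Real.exp (-a * M x)) (Real.exp (-a * M τ) * (-a * M' τ)) τ :=
    (hd.const_mul (-a)).exp
  have hE2 : HasDerivAt (fun x => Real.exp (-μ * x)) (Real.exp (-μ * τ) * (-μ * 1)) τ :=
    ((hasDerivAt_id' τ).const_mul (-μ)).exp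
  have hL := ((hd.const_mul p).mul hE1).mul hE2
  have hR : HasDerivAt (fun x => γ * M x + h) (γ * M' τ) τ := (hd.const_mul γ).add_const h
  have hL' := hR.congr_of_eventuallyEq (f₁ := fun x =>
      p * M x * Real.exp (-a * M x) * Real.exp (-μ * x)) (by
    filter_upwards [isOpen_Ioo.mem_nhds hτ] with x hx using heq x hx)
  have key := hL.unique hL'
  have hg := hg' τ hτ
  have hM := hpos τ hτ
  have e1 := Real.exp_pos (-a * M τ)
  have e2 := Real.exp_pos (-μ * τ)
  simp only [Pi.mul_apply] at key
  generalize Real.exp (-a * M τ) = A at *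
  generalize Real.exp (-μ * τ) = B at *
  have hP : 0 < μ * (p * M τ * A * B) := by positivity
  have h2 : (γ - p * B * A * (1 - a * M τ)) * M' τ = -(μ * (p * M τ * A * B)) := by
    linear_combination -key
  by_contra hn
  have := mul_nonneg (sub_pos.mpr hg).le (not_lt.mp hn)
  linarith
end

section
/- Let a, μ, γ, p > 0, h ≥ 0, let T be an open interval of positive reals, and let M : T → ℝ be differentiable with M(τ) > 0, p·M(τ)·e^{-a·M(τ)}·e^{-μτ} = γ·M(τ) + h, and M′(τ) < 0 for every τ ∈ T. Then the function I(τ) = p·e^{-μτ}·(a·M(τ) − 1)·e^{-a·M(τ)} − γ is differentiable on T and I′(τ) = M′(τ)·( γ·a + h/M(τ)² ) < 0 for every τ ∈ T; in particular I is strictly decreasing on T. -/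
open Real

theorem I_decreasing
    (a μ γ p h t₁ t₂ : ℝ)
    (ha : 0 < a) (hμ : 0 < μ) (hγ : 0 < γ) (hp : 0 < p) (hh : 0 ≤ h)
    (ht₁ : 0 ≤ t₁)
    (M M' : ℝ → ℝ)
    (hderiv : ∀ τ ∈ Set.Ioo t₁ t₂, HasDerivAt M (M' τ) τ)
    (hpos : ∀ τ ∈ Set.Ioo t₁ t₂, 0 < M τ)
    (heq : ∀ τ ∈ Set.Ioo t₁ t₂,
      p * M τ * Real.exp (-a * M τ) * Real.exp (-μ * τ) = γ * M τ + h)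
    (hM'neg : ∀ τ ∈ Set.Ioo t₁ t₂, M' τ < 0) :
    (∀ τ ∈ Set.Ioo t₁ t₂,
      HasDerivAt
        (fun s => p * Real.exp (-μ * s) * (a * M s - 1) * Real.exp (-a * M s) - γ)
        (M' τ * (γ * a + h / (M τ) ^ 2)) τ ∧
      M' τ * (γ * a + h / (M τ) ^ 2) < 0) ∧
    StrictAntiOn
      (fun s => p * Real.exp (-μ * s) * (a * M s - 1) * Real.exp (-a * M s) - γ)
      (Set.Ioo t₁ t₂) := by
  have key : ∀ τ ∈ Set.Ioo t₁ t₂,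
      HasDerivAt
        (fun s => p * Real.exp (-μ * s) * (a * M s - 1) * Real.exp (-a * M s) - γ)
        (M' τ * (γ * a + h / (M τ) ^ 2)) τ ∧
      M' τ * (γ * a + h / (M τ) ^ 2) < 0 := by
    intro τ hτ
    have hM := hpos τ hτ
    have hM0 : M τ ≠ 0 := hM.ne'
    constructor
    · have hd := hderiv τ hτ
      have h1 : HasDerivAt (fun s => (γ + h / M s) * (a * M s - 1) - γ)
          ((0 * M τ - h * M' τ) / (M τ) ^ 2 * (a * M τ - 1)
            + (γ + h / M τ) * (a * M' τ)) τ :=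
        (((((hasDerivAt_const τ h).div hd hM0).const_add γ).mul
          ((hd.const_mul a).sub_const 1)).sub_const γ)
      have h2 : (0 * M τ - h * M' τ) / (M τ) ^ 2 * (a * M τ - 1)
            + (γ + h / M τ) * (a * M' τ) = M' τ * (γ * a + h / (M τ) ^ 2) := by
        field_simp
        ring
      rw [h2] at h1
      refine h1.congr_of_eventuallyEq ?_
      filter_upwards [isOpen_Ioo.mem_nhds hτ] with s hs
      have hs0 : M s ≠ 0 := (hpos s hs).ne'
      have e : γ + h / M s = p * Real.exp (-a * M s) * Real.exp (-μ * s) := by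
        have := heq s hs
        have e1 : γ + h / M s = (γ * M s + h) / M s := by field_simp
        rw [e1, ← this, div_eq_iff hs0]
        ring
      rw [e]
      ring
    · exact mul_neg_of_neg_of_pos (hM'neg τ hτ) (by positivity)
  refine ⟨key, ?_⟩
  refine strictAntiOn_of_deriv_neg (convex_Ioo t₁ t₂)
    (fun τ hτ => (key τ hτ).1.continuousAt.continuousWithinAt) ?_
  intro τ hτ
  rw [interior_Ioo] at hτ
  rw [(key τ hτ).1.deriv]
  exact (key τ hτ).2
end

section
/- Let a, μ, γ, p > 0 and τ > 0 with p·e^{-μτ} > γ, set M* = (1/a)·( ln(p/γ) − μτ ) and b = a·M* − 1. If there exists ω > 0 such that λ = i·ω is a root of λ + γ − p·e^{-μτ}·e^{-a·M*}·(1 − a·M*)·e^{-λτ} = 0, then b > 1 (equivalently ln(p/γ) − μτ > 2) and ω = γ·√(b² − 1). -/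
open Real Complex

theorem b_gt_one_and_omega_formula
    (a μ γ p τ Ms b : ℝ)
    (ha : 0 < a) (hμ : 0 < μ) (hγ : 0 < γ) (hp : 0 < p) (hτ : 0 < τ)
    (hpe : p * Real.exp (-μ * τ) > γ)
    (hMs : Ms = (1 / a) * (Real.log (p / γ) - μ * τ))
    (hb : b = a * Ms - 1) :
    ∀ ω : ℝ, 0 < ω →
      Complex.I * (ω : ℂ) + (γ : ℂ) -
          ((p * Real.exp (-μ * τ) * Real.exp (-a * Ms) * (1 - a * Ms) : ℝ) : ℂ) *
            Complex.exp (-(Complex.I * (ω : ℂ)) * (τ : ℂ)) = 0 →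
      (b > 1 ∧ Real.log (p / γ) - μ * τ > 2 ∧ ω = γ * Real.sqrt (b ^ 2 - 1)) := by
  intro ω hω h
  have haM : a * Ms = Real.log (p / γ) - μ * τ := by
    rw [hMs]; field_simp
  have hlog : Real.log (p / γ) - μ * τ > 0 := by
    have h1 := Real.log_lt_log hγ hpe
    rw [Real.log_mul hp.ne' (Real.exp_pos _).ne', Real.log_exp] at h1
    rw [Real.log_div hp.ne' hγ.ne']
    linarith
  have hcoef : p * Real.exp (-μ * τ) * Real.exp (-a * Ms) = γ := by
    have h2 : -a * Ms = -μ * τ * (-1) + -Real.log (p / γ) := by linarith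
    rw [mul_assoc, ← Real.exp_add, h2]
    have h3 : -μ * τ + (-μ * τ * (-1) + -Real.log (p / γ)) = -Real.log (p / γ) := by ring
    rw [h3, Real.exp_neg, Real.exp_log (by positivity)]
    field_simp
  have hc : γ * (1 - a * Ms) = -(γ * b) := by rw [hb]; ring
  rw [hcoef, hc] at h
  have he : Complex.exp (-(Complex.I * (ω : ℂ)) * (τ : ℂ))
      = Complex.exp (((-(ω * τ) : ℝ) : ℂ) * Complex.I) := by
    congr 1; push_cast; ring
  have hn : Complex.normSq (Complex.I * (ω : ℂ) + (γ : ℂ)) = (γ * b) ^ 2 := by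
    rw [sub_eq_zero.mp h, he, Complex.normSq_mul, Complex.normSq_ofReal,
      Complex.normSq_eq_norm_sq, Complex.norm_exp_ofReal_mul_I]
    ring
  have hn2 : ω ^ 2 + γ ^ 2 = (γ * b) ^ 2 := by
    rw [← hn, Complex.normSq_apply]
    simp
    ring
  have hbm : b > -1 := by rw [hb, haM]; linarith
  have hprod : 0 < γ ^ 2 * (b ^ 2 - 1) := by nlinarith [pow_pos hω 2]
  have hb2 : 0 < b ^ 2 - 1 := pos_of_mul_pos_right hprod (by positivity)
  have hb1 : b > 1 := by nlinarith
  refine ⟨hb1, by rw [← haM]; linarith, ?_⟩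
  have hω2 : ω ^ 2 = (γ * Real.sqrt (b ^ 2 - 1)) ^ 2 := by
    rw [mul_pow, Real.sq_sqrt hb2.le]; linarith
  exact (pow_left_inj₀ hω.le (by positivity) two_ne_zero).mp hω2
end

section
/- Let γ > 0 and let β : ℝ → ℝ, ω : ℝ → ℝ, θ : ℝ → ℝ be functions defined near a point τ_max > 0 such that ω(τ) = √(β(τ)² − γ²) > 0, θ(τ) ∈ (π/2, π), cos θ(τ) = γ/β(τ), and β(τ) → −γ (i.e. |β(τ)| − γ → 0⁺) as τ → τ_max⁻. Then ω(τ) → 0⁺, θ(τ) → π⁻, and S₀(τ) = τ − θ(τ)/ω(τ) → −∞ as τ → τ_max⁻. -/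
open Real Filter Topology

theorem S0_tends_to_neg_infty
    (γ τmax : ℝ) (hγ : 0 < γ) (hτmax : 0 < τmax)
    (β ω θ : ℝ → ℝ)
    (hev : ∀ᶠ τ in 𝓝[<] τmax,
      ω τ = Real.sqrt (β τ ^ 2 - γ ^ 2) ∧ 0 < ω τ ∧
      θ τ ∈ Set.Ioo (Real.pi / 2) Real.pi ∧
      Real.cos (θ τ) = γ / β τ ∧ β τ < -γ)
    (hβlim : Tendsto β (𝓝[<] τmax) (𝓝 (-γ))) :
    Tendsto ω (𝓝[<] τmax) (𝓝[>] 0) ∧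
    Tendsto θ (𝓝[<] τmax) (𝓝[<] Real.pi) ∧
    Tendsto (fun τ => τ - θ τ / ω τ) (𝓝[<] τmax) atBot := by
  have hω0 : Tendsto ω (𝓝[<] τmax) (𝓝 0) := by
    have h1 : Tendsto (fun τ => Real.sqrt (β τ ^ 2 - γ ^ 2)) (𝓝[<] τmax)
        (𝓝 (Real.sqrt ((-γ) ^ 2 - γ ^ 2))) :=
      ((hβlim.pow 2).sub_const _).sqrt
    have h2 : Real.sqrt ((-γ) ^ 2 - γ ^ 2) = 0 := by simp
    rw [h2] at h1
    refine h1.congr' ?_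
    filter_upwards [hev] with τ h
    exact h.1.symm
  have hω : Tendsto ω (𝓝[<] τmax) (𝓝[>] 0) :=
    tendsto_nhdsWithin_iff.2 ⟨hω0, hev.mono fun τ h => h.2.1⟩
  have hθ0 : Tendsto θ (𝓝[<] τmax) (𝓝 Real.pi) := by
    have h1 : Tendsto (fun τ => γ / β τ) (𝓝[<] τmax) (𝓝 (γ / (-γ))) :=
      tendsto_const_nhds.div hβlim (by linarith)
    have h2 : γ / (-γ) = -1 := by field_simp
    rw [h2] at h1
    have h3 := (Real.continuous_arccos.tendsto (-1)).comp h1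
    rw [Real.arccos_neg_one] at h3
    refine h3.congr' ?_
    filter_upwards [hev] with τ h
    obtain ⟨-, -, ⟨ha, hb⟩, hc, -⟩ := h
    show Real.arccos (γ / β τ) = θ τ
    rw [← hc, Real.arccos_cos (by linarith [Real.pi_pos]) hb.le]
  refine ⟨hω, tendsto_nhdsWithin_iff.2 ⟨hθ0, hev.mono fun τ h => h.2.2.1.2⟩, ?_⟩
  have hq : Tendsto (fun τ => θ τ * (ω τ)⁻¹) (𝓝[<] τmax) atTop :=
    hθ0.pos_mul_atTop Real.pi_pos (tendsto_inv_nhdsGT_zero.comp hω)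
  have hid : Tendsto (fun τ : ℝ => τ) (𝓝[<] τmax) (𝓝 τmax) :=
    tendsto_id.mono_left nhdsWithin_le_nhds
  have := hid.add_atBot (tendsto_neg_atTop_atBot.comp hq)
  refine this.congr fun τ => ?_
  simp only [Function.comp, div_eq_mul_inv, sub_eq_add_neg]
end
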